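/- arXiv:2602.06637 — 5 statements merged into one kernel-verified Lean document; each statement's English description precedes it below -/
import Mathlib

section
/- Let N ≥ 1 and T ≥ 1 be integers and fix i ∈ {1,…,N}. For a sequence s ∈ {1,…,N}^{T−1}, let I_i(s) = #{t ∈ {0,…,T−2} : s_t = i}. Then (1/N^{T−1}) Σ_{s∈{1,…,N}^{T−1}} |1/N − (I_i(s)+1)/(T−1+N)| ≤ (1/N)·√((N−1)/T). -/
open Finset

/-- Second moment of a shifted sum of independent uniform samples of a centred function. -/
theorem card_mul_sum_sq_add_sum {α : Type*} [Fintype α] (f : α → ℝ) (hf : ∑ a, f a = 0)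
    (m : ℕ) (c : ℝ) :
    (Fintype.card α : ℝ) * ∑ s : Fin m → α, (c + ∑ t, f (s t)) ^ 2 =
      (Fintype.card α : ℝ) ^ m * (Fintype.card α * c ^ 2 + m * ∑ a, f a ^ 2) := by
  induction m generalizing c with
  | zero => simp
  | succ m ih =>
    rw [← (Fin.consEquiv fun _ : Fin (m + 1) => α).sum_comp, Fintype.sum_prod_type, mul_sum]
    have hcons : ∀ a : α, (Fintype.card α : ℝ) *
        ∑ s : Fin m → α, (c + ∑ t, f ((Fin.consEquiv fun _ : Fin (m + 1) => α) (a, s) t)) ^ 2 =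
        (Fintype.card α : ℝ) ^ m *
          (Fintype.card α * (c + f a) ^ 2 + m * ∑ a, f a ^ 2) := by
      intro a
      rw [← ih (c + f a)]
      simp [Fin.consEquiv, Fin.sum_univ_succ, add_assoc]
    have hsq : ∑ a, (c + f a) ^ 2 = Fintype.card α * c ^ 2 + ∑ a, f a ^ 2 := by
      simp only [add_sq, sum_add_distrib, ← mul_sum, hf]
      simp
    rw [sum_congr rfl fun a _ => hcons a, ← mul_sum, sum_add_distrib, ← mul_sum, hsq]
    simp only [sum_const, card_univ, nsmul_eq_mul]
    push_cast
    ring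

/-- Variance of the number of occurrences of a value in a uniform random sequence. -/
theorem sum_sq_sub_mul_card_filter_eq (N m : ℕ) (hN : 1 ≤ N) (i : Fin N) :
    ∑ s : Fin m → Fin N, ((m : ℝ) - N * #{t | s t = i}) ^ 2 = (N : ℝ) ^ m * (m * (N - 1)) := by
  have hN0 : (N : ℝ) ≠ 0 := by positivity
  have hf : ∑ a : Fin N, (1 - (N : ℝ) * if a = i then 1 else 0) = 0 := by
    simp [sum_sub_distrib]
  have hf2 : ∑ a : Fin N, (1 - (N : ℝ) * if a = i then 1 else 0) ^ 2 = (N : ℝ) * (N - 1) := by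
    have h : ∀ a : Fin N, (1 - (N : ℝ) * if a = i then 1 else 0) ^ 2 =
        1 + if a = i then (N : ℝ) ^ 2 - 2 * N else 0 := by
      intro a
      split_ifs <;> ring
    simp only [h, sum_add_distrib, sum_ite_eq', mem_univ, if_true, sum_const, card_univ,
      Fintype.card_fin, nsmul_eq_mul]
    ring
  have h := card_mul_sum_sq_add_sum _ hf m 0
  rw [hf2] at h
  have hX : ∀ s : Fin m → Fin N, (0 : ℝ) + ∑ t, (1 - (N : ℝ) * if s t = i then 1 else 0) =
      (m : ℝ) - N * #{t | s t = i} := by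
    intro s
    rw [sum_sub_distrib, ← mul_sum, sum_boole]
    simp
  simp only [hX, Fintype.card_fin] at h
  apply mul_left_cancel₀ hN0
  rw [h]
  ring

/-- expected deviation of the empirical sampling frequency. -/
theorem sampling_frequency_deviation
    (N T : ℕ) (hN : 1 ≤ N) (hT : 1 ≤ T) (i : Fin N) :
    ((N : ℝ) ^ (T - 1))⁻¹ * ∑ s : Fin (T - 1) → Fin N,
        |1 / (N : ℝ) -
          (((Finset.univ.filter (fun t : Fin (T - 1) => s t = i)).card : ℝ) + 1) /
            ((T : ℝ) - 1 + N)| ≤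
      (1 / (N : ℝ)) * Real.sqrt (((N : ℝ) - 1) / T) := by
  obtain ⟨m, rfl⟩ : ∃ m, T = m + 1 := ⟨T - 1, by omega⟩
  have hN1 : (1 : ℝ) ≤ N := by exact_mod_cast hN
  have hNpos : (0 : ℝ) < N := by linarith
  have hm : (0 : ℝ) ≤ m := m.cast_nonneg
  have hpow : (0 : ℝ) < (N : ℝ) ^ m := by positivity
  have hdev : ∀ x : ℝ, |1 / (N : ℝ) - (x + 1) / (((m + 1 : ℕ) : ℝ) - 1 + N)| =
      (N * (m + N : ℝ))⁻¹ * |(m : ℝ) - N * x| := by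
    intro x
    rw [← abs_of_pos (show (0 : ℝ) < (N * (m + N : ℝ))⁻¹ by positivity), ← abs_mul]
    congr 1
    push_cast
    rw [add_sub_cancel_right]
    field_simp
    ring
  simp only [hdev, ← mul_sum, Nat.add_sub_cancel]
  have hCS := sq_sum_le_card_mul_sum_sq (s := (univ : Finset (Fin m → Fin N)))
    (f := fun s => |(m : ℝ) - N * #{t | s t = i}|)
  simp only [sq_abs, sum_sq_sub_mul_card_filter_eq N m hN i, card_univ, Fintype.card_fun,
    Fintype.card_fin, Nat.cast_pow] at hCS
  set S := ∑ s : Fin m → Fin N, |(m : ℝ) - N * #{t | s t = i}|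
  have hmean : ((N : ℝ) ^ m)⁻¹ * S / (m + N) ≤ Real.sqrt ((N - 1) / ((m + 1 : ℕ) : ℝ)) := by
    apply Real.le_sqrt_of_sq_le
    calc (((N : ℝ) ^ m)⁻¹ * S / (m + N)) ^ 2
        = S ^ 2 / ((N : ℝ) ^ m * (m + N)) ^ 2 := by field_simp
      _ ≤ (N : ℝ) ^ m * ((N : ℝ) ^ m * (m * (N - 1))) / ((N : ℝ) ^ m * (m + N)) ^ 2 := by
          gcongr
      _ = m * (N - 1) / (m + N) ^ 2 := by field_simp
      _ ≤ (N - 1) / ((m + 1 : ℕ) : ℝ) := by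
          push_cast
          rw [div_le_div_iff₀ (by positivity) (by positivity)]
          have h : (m : ℝ) * (m + 1) ≤ (m + N) ^ 2 := by nlinarith
          nlinarith [mul_le_mul_of_nonneg_left h (sub_nonneg.2 hN1)]
  calc _ = 1 / (N : ℝ) * (((N : ℝ) ^ m)⁻¹ * S / (m + N)) := by field_simp; rfl
    _ ≤ _ := by gcongr
end

section
/- Let N ≥ 1 be an integer, D ≥ 0 a real number, and (δ_k)_{k≥0} a sequence of nonnegative real numbers satisfying δ_{k+1} ≤ (1 − 2/(k+2N))·δ_k + 4D²/(k+2N)² for all k ≥ 0. Then for every integer K ≥ 1, δ_K ≤ 4D²/K + (4N²/K²)·δ_0. -/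
/-- Telescoped form of the recursion, weighted by `(k + 2N - 1)²`. -/
theorem weighted_bound_of_recursion
    (N : ℕ) (hN : 1 ≤ N) (D : ℝ) (δ : ℕ → ℝ) (hδ : ∀ k, 0 ≤ δ k)
    (hrec : ∀ k : ℕ, δ (k + 1) ≤
      (1 - 2 / ((k : ℝ) + 2 * N)) * δ k + 4 * D ^ 2 / ((k : ℝ) + 2 * N) ^ 2) (k : ℕ) :
    ((k : ℝ) + 2 * N - 1) ^ 2 * δ k ≤ (2 * (N : ℝ) - 1) ^ 2 * δ 0 + 4 * D ^ 2 * k := by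
  induction k with
  | zero => simp
  | succ k ih =>
    have hN' : (1 : ℝ) ≤ N := by exact_mod_cast hN
    have hm : 0 < (k : ℝ) + 2 * N := by positivity
    have step := mul_le_mul_of_nonneg_left (hrec k) (sq_nonneg ((k : ℝ) + 2 * N))
    have expand : ((k : ℝ) + 2 * N) ^ 2 *
        ((1 - 2 / ((k : ℝ) + 2 * N)) * δ k + 4 * D ^ 2 / ((k : ℝ) + 2 * N) ^ 2) =
        (((k : ℝ) + 2 * N - 1) ^ 2 - 1) * δ k + 4 * D ^ 2 := by
      field_simp
      ring
    rw [expand] at step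
    have shift : ((k + 1 : ℕ) : ℝ) + 2 * N - 1 = (k : ℝ) + 2 * N := by
      push_cast
      ring
    rw [shift]
    push_cast
    linarith [hδ k]

/-- the block-coordinate Frank-Wolfe recursion implies an `O(1/K)` bound. -/
theorem bcfw_recursion_bound
    (N : ℕ) (hN : 1 ≤ N) (D : ℝ) (hD : 0 ≤ D)
    (δ : ℕ → ℝ) (hδ : ∀ k, 0 ≤ δ k)
    (hrec : ∀ k : ℕ, δ (k + 1) ≤
      (1 - 2 / ((k : ℝ) + 2 * N)) * δ k + 4 * D ^ 2 / ((k : ℝ) + 2 * N) ^ 2) :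
    ∀ K : ℕ, 1 ≤ K → δ K ≤ 4 * D ^ 2 / K + (4 * (N : ℝ) ^ 2 / (K : ℝ) ^ 2) * δ 0 := by
  intro K hK
  have hN' : (1 : ℝ) ≤ N := by exact_mod_cast hN
  have hK' : (0 : ℝ) < K := by exact_mod_cast hK
  have weighted := weighted_bound_of_recursion N hN D δ hδ hrec K
  have lower : (K : ℝ) ^ 2 * δ K ≤ ((K : ℝ) + 2 * N - 1) ^ 2 * δ K :=
    mul_le_mul_of_nonneg_right (pow_le_pow_left₀ hK'.le (by linarith) 2) (hδ K)
  have upper : (2 * (N : ℝ) - 1) ^ 2 * δ 0 ≤ 4 * (N : ℝ) ^ 2 * δ 0 :=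
    mul_le_mul_of_nonneg_right (by nlinarith) (hδ 0)
  have combine : 4 * D ^ 2 / K + (4 * (N : ℝ) ^ 2 / (K : ℝ) ^ 2) * δ 0 =
      (4 * D ^ 2 * K + 4 * (N : ℝ) ^ 2 * δ 0) / (K : ℝ) ^ 2 := by
    field_simp
  rw [combine, le_div_iff₀ (by positivity)]
  linarith
end

section
/- (Shapley–Folkman) Let V_1, …, V_n be nonempty subsets of ℝ^p and suppose x ∈ Σ_{i=1}^n convexHull(V_i) (Minkowski sum). Then there exists a subset S ⊆ {1,…,n} with |S| ≤ p such that x ∈ Σ_{i∈S} convexHull(V_i) + Σ_{i∉S} V_i. -/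
open Finset

/-- **Conic Carathéodory theorem**: a nonnegative combination of vectors is a positive combination
of a linearly independent subfamily. -/
theorem exists_pos_combination_linearIndepOn {ι F : Type*} [AddCommGroup F] [Module ℝ F]
    (f : ι → F) (T : Finset ι) (w : ι → ℝ) (hw : ∀ j ∈ T, 0 ≤ w j) :
    ∃ T' ⊆ T, ∃ w' : ι → ℝ, (∀ j ∈ T', 0 < w' j) ∧
      ∑ j ∈ T', w' j • f j = ∑ j ∈ T, w j • f j ∧ LinearIndepOn ℝ f (T' : Set ι) := by
  classical
  induction T using Finset.strongInduction generalizing w with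
  | H T ih =>
  have key : ∀ k : ι → ℝ, (∀ j ∈ T, 0 ≤ k j) → ∑ j ∈ T, k j • f j = ∑ j ∈ T, w j • f j →
      ∀ i ∈ T, k i = 0 → ∃ T' ⊆ T, ∃ w' : ι → ℝ, (∀ j ∈ T', 0 < w' j) ∧
      ∑ j ∈ T', w' j • f j = ∑ j ∈ T, w j • f j ∧ LinearIndepOn ℝ f (T' : Set ι) := by
    intro k hk hsum i hi hki
    obtain ⟨T', hT', w', hpos, hsum', hlin⟩ :=
      ih (T.erase i) (erase_ssubset hi) k fun j hj => hk j (mem_of_mem_erase hj)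
    refine ⟨T', hT'.trans (erase_subset _ _), w', hpos, ?_, hlin⟩
    rw [hsum', ← hsum]
    exact sum_erase _ (by rw [hki, zero_smul])
  by_cases hzero : ∃ i ∈ T, w i = 0
  · obtain ⟨i, hi, hwi⟩ := hzero
    exact key w hw rfl i hi hwi
  by_cases hlin : LinearIndepOn ℝ f (T : Set ι)
  · push Not at hzero
    exact ⟨T, Finset.Subset.refl T, w, fun j hj => (hw j hj).lt_of_ne' (hzero j hj), rfl, hlin⟩
  obtain ⟨g, hg, hgpos⟩ : ∃ g : ι → ℝ, ∑ j ∈ T, g j • f j = 0 ∧ ∃ j ∈ T, 0 < g j := by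
    rw [linearIndepOn_finset_iff] at hlin
    push Not at hlin
    obtain ⟨g, hg, j, hj, hgj⟩ := hlin
    rcases lt_or_gt_of_ne hgj with h | h
    · exact ⟨-g, by simp [hg], j, hj, by simpa using h⟩
    · exact ⟨g, hg, j, hj, h⟩
  obtain ⟨i, hi, hmin⟩ : ∃ i ∈ T.filter (0 < g ·), ∀ j ∈ T.filter (0 < g ·),
      w i / g i ≤ w j / g j := by
    obtain ⟨j, hj, hgj⟩ := hgpos
    exact exists_min_image _ _ ⟨j, mem_filter.mpr ⟨hj, hgj⟩⟩
  obtain ⟨hiT, hgi⟩ := mem_filter.mp hi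
  refine key (fun j => w j - w i / g i * g j) (fun j hj => ?_) ?_ i hiT ?_
  · rcases lt_or_ge 0 (g j) with h | h
    · exact sub_nonneg.mpr ((le_div_iff₀ h).mp (hmin j (mem_filter.mpr ⟨hj, h⟩)))
    · have := mul_nonpos_of_nonneg_of_nonpos (div_nonneg (hw i hiT) hgi.le) h
      linarith [hw j hj]
  · simp only [sub_smul, mul_smul, sum_sub_distrib, ← smul_sum, hg, smul_zero, sub_zero]
  · simp [hgi.ne']

/-- The **Shapley–Folkman theorem** in a finite-dimensional real vector space. -/
theorem exists_sum_convexHull_card_le_finrank {ι E : Type*} [Fintype ι] [AddCommGroup E]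
    [Module ℝ E] [FiniteDimensional ℝ E] (V : ι → Set E) (y : ι → E)
    (hy : ∀ i, y i ∈ convexHull ℝ (V i)) :
    ∃ S : Finset ι, S.card ≤ Module.finrank ℝ E ∧ ∃ z : ι → E,
      (∀ i ∈ S, z i ∈ convexHull ℝ (V i)) ∧ (∀ i ∉ S, z i ∈ V i) ∧ ∑ i, y i = ∑ i, z i := by
  classical
  have hrep : ∀ i, ∃ t : Finset E, ↑t ⊆ V i ∧ ∃ w : E → ℝ, (∀ v ∈ t, 0 ≤ w v) ∧
      ∑ v ∈ t, w v = 1 ∧ ∑ v ∈ t, w v • v = y i := by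
    intro i
    have h := hy i
    rw [convexHull_eq_union_convexHull_finite_subsets] at h
    simp only [Set.mem_iUnion] at h
    obtain ⟨t, ht, h⟩ := h
    exact ⟨t, ht, Finset.mem_convexHull'.mp h⟩
  choose t htV w hw hw1 hwy using hrep
  let f : (Σ _ : ι, E) → E × (ι → ℝ) := fun j => (j.2, Pi.single j.1 1)
  obtain ⟨T, hT, c, hc, hsum, hlin⟩ := exists_pos_combination_linearIndepOn f (univ.sigma t)
    (fun j => w j.1 j.2) fun j hj => hw _ _ (mem_sigma.mp hj).2
  let A : ι → Finset (Σ _ : ι, E) := fun i => T.filter (·.1 = i)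
  have hAV : ∀ i, ∀ j ∈ A i, j.2 ∈ V i := by
    intro i j hj
    obtain ⟨hjT, rfl⟩ := mem_filter.mp hj
    exact htV _ (mem_sigma.mp (hT hjT)).2
  have hfst : ∑ j ∈ T, c j • j.2 = ∑ i, y i := by
    have h := congrArg Prod.fst hsum
    simpa [f, Prod.fst_sum, sum_sigma, hwy] using h
  have hone : ∀ i, ∑ j ∈ A i, c j = 1 := by
    intro i
    have h := congrFun (congrArg Prod.snd hsum) i
    simp only [f, Prod.snd_sum, Prod.smul_snd, Finset.sum_apply, Pi.smul_apply, sum_sigma,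
      Pi.single_apply, smul_eq_mul, mul_ite, mul_one, mul_zero] at h
    simp only [A, sum_filter, eq_comm (b := i)]
    rw [h, sum_eq_single i]
    · simp [hw1]
    · intro b _ hb
      simp [hb.symm]
    · simp
  have hpos : ∀ i, 1 ≤ (A i).card := by
    intro i
    rw [Nat.one_le_iff_ne_zero, Ne, card_eq_zero]
    intro h
    simpa [h] using hone i
  have hcard : T.card ≤ Module.finrank ℝ E + Fintype.card ι := by
    have h := LinearIndependent.fintype_card_le_finrank hlin
    simpa using h
  have hfib : ∑ i, (A i).card = T.card := (card_eq_sum_card_fiberwise fun _ _ => mem_univ _).symm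
  refine ⟨univ.filter fun i => 2 ≤ (A i).card, ?_, fun i => ∑ j ∈ A i, c j • j.2, ?_, ?_, ?_⟩
  · have h : ∑ i, (1 + if 2 ≤ (A i).card then 1 else 0) ≤ ∑ i, (A i).card := by
      refine sum_le_sum fun i _ => ?_
      have := hpos i
      split_ifs <;> omega
    rw [sum_add_distrib, ← card_filter, sum_const, card_univ, smul_eq_mul, mul_one] at h
    omega
  · intro i _
    exact (convex_convexHull ℝ (V i)).sum_mem (fun j hj => (hc j (mem_filter.mp hj).1).le)
      (hone i) fun j hj => subset_convexHull ℝ _ (hAV i j hj)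
  · intro i hi
    have hi' : (A i).card = 1 := by
      have := hpos i
      simp only [mem_filter, mem_univ, true_and] at hi
      omega
    obtain ⟨j, hj⟩ := card_eq_one.mp hi'
    have hcj : c j = 1 := by simpa [hj] using hone i
    simpa [hj, hcj] using hAV i j (by simp [hj])
  · rw [← hfst]
    exact (sum_fiberwise T _ _).symm

/-- the Shapley-Folkman theorem. -/
theorem shapley_folkman
    (n p : ℕ) (V : Fin n → Set (EuclideanSpace ℝ (Fin p)))
    (hV : ∀ i, (V i).Nonempty)
    (x : EuclideanSpace ℝ (Fin p))
    (hx : ∃ y : (∀ _ : Fin n, EuclideanSpace ℝ (Fin p)),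
      (∀ i, y i ∈ convexHull ℝ (V i)) ∧ x = ∑ i, y i) :
    ∃ S : Finset (Fin n), S.card ≤ p ∧
      ∃ y : (∀ _ : Fin n, EuclideanSpace ℝ (Fin p)),
        (∀ i ∈ S, y i ∈ convexHull ℝ (V i)) ∧ (∀ i ∉ S, y i ∈ V i) ∧ x = ∑ i, y i := by
  obtain ⟨y, hy, rfl⟩ := hx
  simpa only [finrank_euclideanSpace_fin] using exists_sum_convexHull_card_le_finrank V y hy
end

section
/- (Aubin–Ekeland duality gap bound) There exists x* = (x_1*, …, x_N*) with x_i* ∈ D_i for all i and (1/N)Σ_{i=1}^N A_i x_i* ≤ b componentwise, such that d* ≤ (1/N)Σ_{i=1}^N f_i(x_i*) ≤ d* + ((m+1)/N)·max_{1≤i≤N} ρ(f_i). -/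
open scoped RealInnerProductSpace
open Finset

/-- Fenchel conjugate of `f` restricted to the set `Dset`. -/
noncomputable def fConj {n : ℕ} (Dset : Set (EuclideanSpace ℝ (Fin n)))
    (f : EuclideanSpace ℝ (Fin n) → ℝ) (y : EuclideanSpace ℝ (Fin n)) : ℝ :=
  sSup ((fun x => ⟪y, x⟫ - f x) '' Dset)

/-- Biconjugate of `f` (with domain `Dset`). -/
noncomputable def fBiconj {n : ℕ} (Dset : Set (EuclideanSpace ℝ (Fin n)))
    (f : EuclideanSpace ℝ (Fin n) → ℝ) (x : EuclideanSpace ℝ (Fin n)) : ℝ :=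
  sSup (Set.range fun y : EuclideanSpace ℝ (Fin n) => ⟪y, x⟫ - fConj Dset f y)

/-- Nonconvexity `ρ(f)` of `f` over the set `Dset` (Aubin--Ekeland). -/
noncomputable def nonconvexity {n : ℕ} (Dset : Set (EuclideanSpace ℝ (Fin n)))
    (f : EuclideanSpace ℝ (Fin n) → ℝ) : ℝ :=
  sSup {r : ℝ | ∃ (p : ℕ) (xs : Fin p → EuclideanSpace ℝ (Fin n)) (a : Fin p → ℝ),
    (∀ j, xs j ∈ Dset) ∧ (∀ j, 0 ≤ a j) ∧ (∑ j, a j) = 1 ∧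
    r = f (∑ j, a j • xs j) - ∑ j, a j * f (xs j)}

/-- **Shapley–Folkman lemma**: a sum of points of convex hulls can be rewritten so that at most
`finrank ℝ E` of the summands lie outside the original sets. -/
theorem shapley_folkman_s17 {ι E : Type*} [Fintype ι] [AddCommGroup E] [Module ℝ E]
    [FiniteDimensional ℝ E] (S : ι → Set E) (y : ι → E) (hy : ∀ i, y i ∈ convexHull ℝ (S i)) :
    ∃ z : ι → E, ∑ i, z i = ∑ i, y i ∧ (∀ i, z i ∈ convexHull ℝ (S i)) ∧
      ∃ J : Finset ι, #J ≤ Module.finrank ℝ E ∧ ∀ i ∉ J, z i ∈ S i := by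
  classical
  cases isEmpty_or_nonempty ι
  · exact ⟨y, rfl, hy, ∅, by simp, fun i => isEmptyElim i⟩
  have hn : (0 : ℝ) < Fintype.card ι := by exact_mod_cast Fintype.card_pos
  set n : ℝ := ((Fintype.card ι : ℕ) : ℝ) with hn_def
  let T : Set (E × (ι → ℝ)) := ⋃ i, S i ×ˢ {Pi.single i 1}
  have hP : ∑ i, n⁻¹ • (y i, (Pi.single i 1 : ι → ℝ)) ∈ convexHull ℝ T := by
    refine (convex_convexHull ℝ T).sum_mem (fun _ _ => by positivity) ?_ fun i _ => ?_
    · simp [← hn_def, hn.ne']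
    · refine convexHull_mono (Set.subset_iUnion _ i) ?_
      rw [convexHull_prod]
      exact ⟨hy i, by simp⟩
  obtain ⟨κ, _, p, w, hpT, hind, hw, hw1, hsum⟩ := eq_pos_convex_span_of_mem_convexHull hP
  have hmem (k : κ) : ∃ i, (p k).1 ∈ S i ∧ (p k).2 = Pi.single i 1 := by
    simpa [T] using hpT ⟨k, rfl⟩
  choose c hcS hc using hmem
  have hfib (i : ι) : ∑ k with c k = i, w k = n⁻¹ := by
    have h := congrFun (congrArg Prod.snd hsum) i
    simpa [Prod.snd_sum, Finset.sum_apply, hc, Pi.single_apply, Finset.sum_filter,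
      eq_comm] using h
  have hfib' (i : ι) : ∑ k with c k = i, n * w k = 1 := by
    rw [← Finset.mul_sum, hfib, mul_inv_cancel₀ hn.ne']
  have hfst : ∑ k, w k • (p k).1 = n⁻¹ • ∑ i, y i := by
    have h := congrArg Prod.fst hsum
    simpa [Prod.fst_sum, Finset.smul_sum] using h
  refine ⟨fun i => ∑ k with c k = i, (n * w k) • (p k).1, ?_, fun i => ?_,
    ({i | 1 < #{k | c k = i}} : Finset ι), ?_, fun i hi => ?_⟩
  · refine (Finset.sum_fiberwise Finset.univ c fun k => (n * w k) • (p k).1).trans ?_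
    simp_rw [mul_smul]
    rw [← Finset.smul_sum, hfst, smul_inv_smul₀ hn.ne']
  · refine (convex_convexHull ℝ (S i)).sum_mem (fun k _ => by have := hw k; positivity)
      (hfib' i) fun k hk => subset_convexHull ℝ _ ?_
    have := hcS k
    rwa [(Finset.mem_filter.mp hk).2] at this
  · let φ : E × (ι → ℝ) →ₗ[ℝ] ℝ := (∑ i, LinearMap.proj i) ∘ₗ LinearMap.snd ℝ E (ι → ℝ)
    have hφ (k : κ) : φ (p k) = 1 := by
      simp [φ, hc]
    have hker : vectorSpan ℝ (Set.range p) ≤ LinearMap.ker φ := by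
      rw [vectorSpan_def, Submodule.span_le]
      rintro _ ⟨_, ⟨k, rfl⟩, _, ⟨l, rfl⟩, rfl⟩
      simp [hφ]
    have hne : LinearMap.ker φ ≠ ⊤ := by
      obtain ⟨i⟩ := ‹Nonempty ι›
      intro h
      have : φ (0, Pi.single i 1) = 0 := by
        rw [← LinearMap.mem_ker, h]; trivial
      simp [φ] at this
    have h1 := hind.card_le_finrank_succ
    have h2 := Submodule.finrank_mono hker
    have h3 := Submodule.finrank_lt hne
    rw [Module.finrank_prod, Module.finrank_fintype_fun_eq_card] at h3
    have h4 : Fintype.card κ = ∑ i, #{k | c k = i} :=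
      Finset.card_eq_sum_card_fiberwise (by simp)
    have h5 : ∑ i, (1 + if 1 < #{k | c k = i} then 1 else 0) ≤ ∑ i, #{k | c k = i} := by
      refine Finset.sum_le_sum fun i _ => ?_
      have : 0 < #{k | c k = i} := by
        refine Finset.card_pos.mpr (Finset.nonempty_of_sum_ne_zero (f := w) ?_)
        rw [hfib]; positivity
      split_ifs <;> omega
    rw [Finset.sum_add_distrib, ← Finset.card_filter] at h5
    simp only [Finset.sum_const, Finset.card_univ, smul_eq_mul, mul_one] at h5
    omega
  · have hcard : #{k | c k = i} = 1 := by
      have : 0 < #{k | c k = i} := by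
        refine Finset.card_pos.mpr (Finset.nonempty_of_sum_ne_zero (f := w) ?_)
        rw [hfib]; positivity
      simp only [Finset.mem_filter, Finset.mem_univ, true_and] at hi
      omega
    obtain ⟨k, hk⟩ := Finset.card_eq_one.mp hcard
    have hki : c k = i := by
      have : k ∈ ({k | c k = i} : Finset κ) := by simp [hk]
      simpa using this
    have h1 := hfib' i
    rw [hk, Finset.sum_singleton] at h1
    have h2 := hcS k
    rw [hki] at h2
    simpa only [hk, Finset.sum_singleton, h1, one_smul] using h2

/-- The epigraph of `f` over `Dset`. -/
def epigraphOn {E : Type*} (Dset : Set E) (f : E → ℝ) : Set (E × ℝ) :=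
  {q | q.1 ∈ Dset ∧ f q.1 ≤ q.2}

section Nonconvexity

variable {n : ℕ} {Dset : Set (EuclideanSpace ℝ (Fin n))} {f : EuclideanSpace ℝ (Fin n) → ℝ}

lemma sub_sum_le_nonconvexity (hD : Convex ℝ Dset) (hf : ∃ c : ℝ, ∀ x ∈ Dset, |f x| ≤ c)
    {κ : Type*} [Fintype κ] {z : κ → EuclideanSpace ℝ (Fin n)} {w : κ → ℝ}
    (hz : ∀ k, z k ∈ Dset) (hw : ∀ k, 0 ≤ w k) (hw1 : ∑ k, w k = 1) :
    f (∑ k, w k • z k) - ∑ k, w k * f (z k) ≤ nonconvexity Dset f := by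
  obtain ⟨c, hc⟩ := hf
  refine le_csSup ⟨c + c, ?_⟩ ?_
  · rintro _ ⟨p, xs, a, hxs, ha, ha1, rfl⟩
    have h1 := (abs_le.mp (hc _ (hD.sum_mem (fun j _ => ha j) ha1 fun j _ => hxs j))).2
    have h2 : ∑ j, a j * (-c) ≤ ∑ j, a j * f (xs j) :=
      Finset.sum_le_sum fun j _ =>
        mul_le_mul_of_nonneg_left (abs_le.mp (hc _ (hxs j))).1 (ha j)
    rw [← Finset.sum_mul, ha1] at h2
    linarith
  · let e := (Fintype.equivFin κ).symm
    refine ⟨Fintype.card κ, z ∘ e, w ∘ e, fun j => hz _, fun j => hw _, ?_, ?_⟩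
    · simpa using (e.sum_comp w).trans hw1
    · simp only [Function.comp_apply]
      rw [e.sum_comp (fun k => w k • z k), e.sum_comp (fun k => w k * f (z k))]

lemma nonconvexity_nonneg (hne : Dset.Nonempty) (hD : Convex ℝ Dset)
    (hf : ∃ c : ℝ, ∀ x ∈ Dset, |f x| ≤ c) : 0 ≤ nonconvexity Dset f := by
  obtain ⟨x, hx⟩ := hne
  simpa using sub_sum_le_nonconvexity hD hf (κ := Unit) (z := fun _ => x) (w := fun _ => 1)
    (fun _ => hx) (by simp) (by simp)

lemma le_add_nonconvexity_of_mem_convexHull_epigraphOn (hD : Convex ℝ Dset)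
    (hf : ∃ c : ℝ, ∀ x ∈ Dset, |f x| ≤ c) {q : EuclideanSpace ℝ (Fin n) × ℝ}
    (hq : q ∈ convexHull ℝ (epigraphOn Dset f)) :
    q.1 ∈ Dset ∧ f q.1 ≤ q.2 + nonconvexity Dset f := by
  obtain ⟨κ, _, w, z, hw, hw1, hz, rfl⟩ := mem_convexHull_iff_exists_fintype.mp hq
  have h := sub_sum_le_nonconvexity hD hf (fun k => (hz k).1) hw hw1
  have h2 : ∑ k, w k * f (z k).1 ≤ ∑ k, w k * (z k).2 :=
    Finset.sum_le_sum fun k _ => mul_le_mul_of_nonneg_left (hz k).2 (hw k)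
  simp only [Prod.fst_sum, Prod.snd_sum, Prod.smul_fst, Prod.smul_snd, smul_eq_mul]
  exact ⟨hD.sum_mem (fun k _ => hw k) hw1 fun k _ => (hz k).1, by linarith⟩

lemma bddAbove_image_inner_sub (hD : IsCompact Dset) (hf : ∃ c : ℝ, ∀ x ∈ Dset, |f x| ≤ c)
    (y : EuclideanSpace ℝ (Fin n)) : BddAbove ((fun x => ⟪y, x⟫ - f x) '' Dset) := by
  obtain ⟨c, hc⟩ := hf
  obtain ⟨C, hC⟩ := hD.bddAbove_image (f := fun x => ⟪y, x⟫) (by fun_prop)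
  refine ⟨C + c, ?_⟩
  rintro _ ⟨x, hx, rfl⟩
  have h1 : ⟪y, x⟫ ≤ C := hC ⟨x, hx, rfl⟩
  have h2 := (abs_le.mp (hc x hx)).1
  simp only
  linarith

lemma inner_sub_fConj_le (hD : IsCompact Dset) (hf : ∃ c : ℝ, ∀ x ∈ Dset, |f x| ≤ c)
    {x : EuclideanSpace ℝ (Fin n)} (hx : x ∈ Dset) (y : EuclideanSpace ℝ (Fin n)) :
    ⟪y, x⟫ - fConj Dset f y ≤ f x := by
  have : ⟪y, x⟫ - f x ≤ fConj Dset f y :=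
    le_csSup (bddAbove_image_inner_sub hD hf y) ⟨x, hx, rfl⟩
  linarith

lemma fBiconj_le (hD : IsCompact Dset) (hf : ∃ c : ℝ, ∀ x ∈ Dset, |f x| ≤ c)
    {x : EuclideanSpace ℝ (Fin n)} (hx : x ∈ Dset) : fBiconj Dset f x ≤ f x :=
  csSup_le (Set.range_nonempty _) (Set.forall_mem_range.mpr (inner_sub_fConj_le hD hf hx))

lemma inner_sub_fConj_le_fBiconj (hD : IsCompact Dset) (hf : ∃ c : ℝ, ∀ x ∈ Dset, |f x| ≤ c)
    {x : EuclideanSpace ℝ (Fin n)} (hx : x ∈ Dset) (y : EuclideanSpace ℝ (Fin n)) :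
    ⟪y, x⟫ - fConj Dset f y ≤ fBiconj Dset f x :=
  le_csSup ⟨f x, Set.forall_mem_range.mpr (inner_sub_fConj_le hD hf hx)⟩ ⟨y, rfl⟩

lemma mk_fBiconj_mem_closure_convexHull_epigraphOn (hD : IsCompact Dset)
    (hf : ∃ c : ℝ, ∀ x ∈ Dset, |f x| ≤ c) {x : EuclideanSpace ℝ (Fin n)} (hx : x ∈ Dset) :
    (x, fBiconj Dset f x) ∈ closure (convexHull ℝ (epigraphOn Dset f)) := by
  by_contra hnot
  obtain ⟨g, u, hgu, hug⟩ := geometric_hahn_banach_point_closed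
    (convex_convexHull ℝ (epigraphOn Dset f)).closure isClosed_closure hnot
  replace hug : ∀ q ∈ epigraphOn Dset f, u < g q := fun q hq =>
    hug q (subset_closure (subset_convexHull ℝ _ hq))
  set s : ℝ := g (0, 1)
  let y := (InnerProductSpace.toDual ℝ (EuclideanSpace ℝ (Fin n))).symm
    (g.comp (ContinuousLinearMap.inl ℝ _ ℝ))
  have hg (v : EuclideanSpace ℝ (Fin n)) (t : ℝ) : g (v, t) = ⟪y, v⟫ + t * s := by
    have h1 : ⟪y, v⟫ = g (v, 0) := by
      simp [y, InnerProductSpace.toDual_symm_apply]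
    have h2 : (v, t) = (v, (0 : ℝ)) + t • ((0 : EuclideanSpace ℝ (Fin n)), (1 : ℝ)) := by simp
    rw [h1, h2, map_add, map_smul, smul_eq_mul]
  have hle := fBiconj_le hD hf hx
  have hxf := hug (x, f x) ⟨hx, le_rfl⟩
  rw [hg] at hgu hxf
  have hs : 0 < s := by
    by_contra! h
    nlinarith
  have hconj : fConj Dset f (-(s⁻¹ • y)) ≤ -(s⁻¹ * u) := by
    refine csSup_le (Set.Nonempty.image _ ⟨x, hx⟩) ?_
    rintro _ ⟨v, hv, rfl⟩
    have h := hug (v, f v) ⟨hv, le_rfl⟩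
    rw [hg] at h
    have h' := mul_le_mul_of_nonneg_left h.le (inv_pos.mpr hs).le
    have h'' : s⁻¹ * (⟪y, v⟫ + f v * s) = s⁻¹ * ⟪y, v⟫ + f v := by field_simp
    simp only [inner_neg_left, real_inner_smul_left]
    linarith
  have h1 := inner_sub_fConj_le_fBiconj hD hf hx (-(s⁻¹ • y))
  have h2 := mul_lt_mul_of_pos_left hgu (inv_pos.mpr hs)
  have h3 : s⁻¹ * (⟪y, x⟫ + fBiconj Dset f x * s) = s⁻¹ * ⟪y, x⟫ + fBiconj Dset f x := by
    field_simp
  simp only [inner_neg_left, real_inner_smul_left] at h1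
  linarith

end Nonconvexity

/-- Points of the convexified epigraphs can be replaced by points of the sets `Di i` with the same
image under the coupling maps, losing at most `m + 1` times the nonconvexity in the values. -/
theorem exists_sum_map_eq_and_sum_le {ι : Type*} [Fintype ι] {m : ℕ} {dim : ι → ℕ}
    {Di : ∀ i, Set (EuclideanSpace ℝ (Fin (dim i)))} {f : ∀ i, EuclideanSpace ℝ (Fin (dim i)) → ℝ}
    (hD : ∀ i, Convex ℝ (Di i)) (hf : ∀ i, ∃ c : ℝ, ∀ x ∈ Di i, |f i x| ≤ c)
    (A : ∀ i, EuclideanSpace ℝ (Fin (dim i)) →ₗ[ℝ] EuclideanSpace ℝ (Fin m))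
    {R : ℝ} (hR0 : 0 ≤ R) (hR : ∀ i, nonconvexity (Di i) (f i) ≤ R)
    {q : ∀ i, EuclideanSpace ℝ (Fin (dim i)) × ℝ}
    (hq : ∀ i, q i ∈ convexHull ℝ (epigraphOn (Di i) (f i))) :
    ∃ x : ∀ i, EuclideanSpace ℝ (Fin (dim i)), (∀ i, x i ∈ Di i) ∧
      ∑ i, A i (x i) = ∑ i, A i (q i).1 ∧
      ∑ i, f i (x i) ≤ ∑ i, (q i).2 + ((m : ℝ) + 1) * R := by
  classical
  let L (i : ι) : EuclideanSpace ℝ (Fin (dim i)) × ℝ →ₗ[ℝ] EuclideanSpace ℝ (Fin m) × ℝ :=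
    (A i).prodMap LinearMap.id
  obtain ⟨z, hsum, hz, J, hJ, hzJ⟩ := shapley_folkman_s17
    (fun i => L i '' epigraphOn (Di i) (f i)) (fun i => L i (q i)) fun i => by
      rw [← (L i).image_convexHull]
      exact ⟨q i, hq i, rfl⟩
  have key (i : ι) : ∃ x ∈ Di i, A i x = (z i).1 ∧
      f i x ≤ (z i).2 + if i ∈ J then R else 0 := by
    by_cases hi : i ∈ J
    · have h := hz i
      rw [← (L i).image_convexHull] at h
      obtain ⟨r, hr, hrz⟩ := h
      obtain ⟨h1, h2⟩ := le_add_nonconvexity_of_mem_convexHull_epigraphOn (hD i) (hf i) hr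
      refine ⟨r.1, h1, by simp [← hrz, L], ?_⟩
      have h3 : (z i).2 = r.2 := by simp [← hrz, L]
      rw [if_pos hi, h3]
      linarith [hR i]
    · obtain ⟨r, hr, hrz⟩ := hzJ i hi
      refine ⟨r.1, hr.1, by simp [← hrz, L], ?_⟩
      have h3 : (z i).2 = r.2 := by simp [← hrz, L]
      rw [if_neg hi, h3, add_zero]
      exact hr.2
  choose x hxD hxA hxf using key
  refine ⟨x, hxD, ?_, ?_⟩
  · simp_rw [hxA]
    simpa [Prod.fst_sum, L] using congrArg Prod.fst hsum
  · have h1 : ∑ i, (z i).2 = ∑ i, (q i).2 := by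
      simpa [Prod.snd_sum, L] using congrArg Prod.snd hsum
    have h2 : (#J : ℝ) ≤ m + 1 := by
      rw [Module.finrank_prod, finrank_euclideanSpace_fin, Module.finrank_self] at hJ
      exact_mod_cast hJ
    calc ∑ i, f i (x i) ≤ ∑ i, ((z i).2 + if i ∈ J then R else 0) :=
          Finset.sum_le_sum fun i _ => hxf i
      _ = ∑ i, (q i).2 + #J * R := by
          rw [Finset.sum_add_distrib, h1]; simp
      _ ≤ _ := by gcongr

/-- Aubin--Ekeland duality gap bound. -/
theorem aubin_ekeland_duality_gap_bound
    (N m : ℕ) (hN : 1 ≤ N) (dim : Fin N → ℕ)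
    (Di : ∀ i : Fin N, Set (EuclideanSpace ℝ (Fin (dim i))))
    (hDne : ∀ i, (Di i).Nonempty)
    (hDcvx : ∀ i, Convex ℝ (Di i))
    (hDcpt : ∀ i, IsCompact (Di i))
    (f : ∀ i : Fin N, EuclideanSpace ℝ (Fin (dim i)) → ℝ)
    (hflsc : ∀ i, LowerSemicontinuousOn (f i) (Di i))
    (hfbdd : ∀ i, ∃ c : ℝ, ∀ x ∈ Di i, |f i x| ≤ c)
    (A : ∀ i : Fin N, EuclideanSpace ℝ (Fin (dim i)) →ₗ[ℝ] EuclideanSpace ℝ (Fin m))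
    (b : EuclideanSpace ℝ (Fin m))
    (dF : EuclideanSpace ℝ (Fin m) → ℝ)
    (hdF : ∀ lam : EuclideanSpace ℝ (Fin m), dF lam = -⟪lam, b⟫ +
      (N : ℝ)⁻¹ * ∑ i, sInf ((fun x => f i x + ⟪lam, A i x⟫) '' Di i))
    (dstar : ℝ)
    (hdstar : IsLUB (dF '' {lam | ∀ j, 0 ≤ lam j}) dstar)
    (hstrong : IsLeast
      ((fun x : (∀ i : Fin N, EuclideanSpace ℝ (Fin (dim i))) =>
          (N : ℝ)⁻¹ * ∑ i, fBiconj (Di i) (f i) (x i)) ''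
        {x | (∀ i, x i ∈ Di i) ∧ ∀ j, ((N : ℝ)⁻¹ • ∑ i, A i (x i)) j ≤ b j})
      dstar) :
    ∃ xstar : (∀ i : Fin N, EuclideanSpace ℝ (Fin (dim i))),
      (∀ i, xstar i ∈ Di i) ∧
      (∀ j, ((N : ℝ)⁻¹ • ∑ i, A i (xstar i)) j ≤ b j) ∧
      dstar ≤ (N : ℝ)⁻¹ * ∑ i, f i (xstar i) ∧
      (N : ℝ)⁻¹ * ∑ i, f i (xstar i) ≤ dstar + (((m : ℝ) + 1) / N) *
        Finset.univ.sup' (Finset.univ_nonempty_iff.mpr ⟨⟨0, hN⟩⟩)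
          (fun i => nonconvexity (Di i) (f i)) := by
  obtain ⟨⟨x, ⟨hxD, hxb⟩, hxval⟩, hmin⟩ := hstrong
  simp only at hxval
  have hN0 : (0 : ℝ) < N := by exact_mod_cast hN
  set R : ℝ := Finset.univ.sup' (Finset.univ_nonempty_iff.mpr ⟨⟨0, hN⟩⟩)
    (fun i => nonconvexity (Di i) (f i))
  have hR (i : Fin N) : nonconvexity (Di i) (f i) ≤ R :=
    Finset.le_sup' (fun i => nonconvexity (Di i) (f i)) (Finset.mem_univ i)
  have hR0 : 0 ≤ R :=
    (nonconvexity_nonneg (hDne ⟨0, hN⟩) (hDcvx _) (hfbdd _)).trans (hR ⟨0, hN⟩)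
  have hseq (i : Fin N) := mem_closure_iff_seq_limit.mp
    (mk_fBiconj_mem_closure_convexHull_epigraphOn (hDcpt i) (hfbdd i) (hxD i))
  choose q hq hqlim using hseq
  have hstep (k : ℕ) := exists_sum_map_eq_and_sum_le hDcvx hfbdd A hR0 hR (fun i => hq i k)
  choose v hvD hvA hvf using hstep
  have hK : IsCompact (Set.univ.pi Di) := isCompact_univ_pi hDcpt
  obtain ⟨xs, hxs, φ, hφ, hlim⟩ := hK.tendsto_subseq (x := v) fun k i _ => hvD k i
  have hxsD (i : Fin N) : xs i ∈ Di i := hxs i trivial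
  have hφ' := hφ.tendsto_atTop
  have hAc (i : Fin N) : Continuous (A i) := (A i).continuous_of_finiteDimensional
  have hAeq : ∑ i, A i (xs i) = ∑ i, A i (x i) := by
    have h1 : Filter.Tendsto (fun k => ∑ i, A i (v (φ k) i)) Filter.atTop
        (nhds (∑ i, A i (xs i))) :=
      tendsto_finsetSum _ fun i _ =>
        ((hAc i).tendsto _).comp ((continuous_apply i).continuousAt.tendsto.comp hlim)
    have h2 : Filter.Tendsto (fun k => ∑ i, A i (q i (φ k)).1) Filter.atTop
        (nhds (∑ i, A i (x i))) :=
      tendsto_finsetSum _ fun i _ =>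
        ((hAc i).tendsto _).comp
          ((continuous_fst.tendsto _).comp ((hqlim i).comp hφ'))
    simp_rw [hvA] at h1
    exact tendsto_nhds_unique h1 h2
  have hlsc : LowerSemicontinuousOn (fun u : ∀ i, EuclideanSpace ℝ (Fin (dim i)) =>
      ∑ i, f i (u i)) (Set.univ.pi Di) :=
    lowerSemicontinuousOn_sum fun i _ =>
      (hflsc i).comp (continuous_apply i).continuousOn fun u hu => hu i trivial
  have hval : ∑ i, f i (xs i) ≤ ∑ i, fBiconj (Di i) (f i) (x i) + ((m : ℝ) + 1) * R := by
    have hcl := (lowerSemicontinuousOn_iff_isClosed_epigraph hK.isClosed).mp hlsc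
    have ht : Filter.Tendsto (fun k => ∑ i, (q i (φ k)).2 + ((m : ℝ) + 1) * R) Filter.atTop
        (nhds (∑ i, fBiconj (Di i) (f i) (x i) + ((m : ℝ) + 1) * R)) :=
      (tendsto_finsetSum _ fun i _ =>
        (continuous_snd.tendsto _).comp ((hqlim i).comp hφ')).add_const _
    exact (hcl.mem_of_tendsto (hlim.prodMk_nhds ht)
      (Filter.Eventually.of_forall fun k => ⟨fun i _ => hvD _ i, hvf _⟩)).2
  have hfeas (j : Fin m) : ((N : ℝ)⁻¹ • ∑ i, A i (xs i)) j ≤ b j := hAeq ▸ hxb j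
  refine ⟨xs, hxsD, hfeas, ?_, ?_⟩
  · refine (hmin ⟨xs, ⟨hxsD, hfeas⟩, rfl⟩).trans ?_
    exact mul_le_mul_of_nonneg_left
      (Finset.sum_le_sum fun i _ => fBiconj_le (hDcpt i) (hfbdd i) (hxsD i)) (by positivity)
  · calc (N : ℝ)⁻¹ * ∑ i, f i (xs i)
        ≤ (N : ℝ)⁻¹ * (∑ i, fBiconj (Di i) (f i) (x i) + ((m : ℝ) + 1) * R) := by gcongr
      _ = dstar + (((m : ℝ) + 1) / N) * R := by rw [mul_add, hxval]; ring
end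

section
/- If x̃ ∈ D is an extreme point of convexHull(D), then f**(x̃) = f(x̃). If moreover x̃ minimizes the linear function x ↦ ⟨λ, A x⟩ over D, then x̃ also minimizes x ↦ ⟨λ, A x⟩ over convexHull(D). -/
open scoped RealInnerProductSpace
open Finset

theorem isCompact_convexJoin {E : Type*} [AddCommGroup E] [Module ℝ E] [TopologicalSpace E]
    [IsTopologicalAddGroup E] [ContinuousSMul ℝ E] {s t : Set E}
    (hs : IsCompact s) (ht : IsCompact t) : IsCompact (convexJoin ℝ s t) := by
  have h : convexJoin ℝ s t =
      (fun p : ℝ × E × E => (1 - p.1) • p.2.1 + p.1 • p.2.2) '' (Set.Icc 0 1 ×ˢ s ×ˢ t) := by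
    ext x
    simp only [mem_convexJoin, segment_eq_image, Set.mem_image, Set.mem_prod, Prod.exists]
    constructor
    · rintro ⟨a, ha, b, hb, θ, hθ, rfl⟩
      exact ⟨θ, a, b, ⟨hθ, ha, hb⟩, rfl⟩
    · rintro ⟨θ, a, b, ⟨hθ, ha, hb⟩, rfl⟩
      exact ⟨a, ha, b, hb, θ, hθ, rfl⟩
  rw [h]
  exact (isCompact_Icc.prod (hs.prod ht)).image (by fun_prop)

/-- The convex hull of a compact set in a finite-dimensional space is compact. -/
theorem isCompact_convexHull_of_finiteDimensional {E : Type*} [AddCommGroup E] [Module ℝ E]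
    [TopologicalSpace E] [IsTopologicalAddGroup E] [ContinuousSMul ℝ E] [FiniteDimensional ℝ E]
    {s : Set E} (hs : IsCompact s) : IsCompact (convexHull ℝ s) := by
  let C : ℕ → Set E := fun k => (convexJoin ℝ s)^[k] s
  have hC_succ (k : ℕ) : C (k + 1) = convexJoin ℝ s (C k) :=
    Function.iterate_succ_apply' (convexJoin ℝ s) k s
  have hC_compact (k : ℕ) : IsCompact (C k) := by
    induction k with
    | zero => exact hs
    | succ k ih => rw [hC_succ]; exact isCompact_convexJoin hs ih
  have hC_sub (k : ℕ) : C k ⊆ convexHull ℝ s := by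
    induction k with
    | zero => exact subset_convexHull ℝ s
    | succ k ih =>
      rw [hC_succ]
      exact convexJoin_subset (subset_convexHull ℝ s) ih (convex_convexHull ℝ s)
  have hC_mono : Monotone C := by
    refine monotone_nat_of_le_succ fun k x hx => ?_
    rw [hC_succ]
    exact subset_convexJoin_right (convexHull_nonempty_iff.1 ⟨x, hC_sub k hx⟩) hx
  have hC_finset (t : Finset E) :
      (t : Set E) ⊆ s → convexHull ℝ (t : Set E) ⊆ C (t.card - 1) := by
    classical
    induction t using Finset.induction_on with
    | empty => simp
    | insert a t ha ih =>
      intro hts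
      rw [Finset.coe_insert, Set.insert_subset_iff] at hts
      rw [Finset.coe_insert, Finset.card_insert_of_notMem ha, Nat.add_sub_cancel]
      rcases t.eq_empty_or_nonempty with rfl | hne
      · simpa [C] using hts.1
      · rw [convexHull_insert (Finset.coe_nonempty.2 hne),
          ← Nat.sub_add_cancel (Finset.card_pos.2 hne), hC_succ]
        exact convexJoin_mono (Set.singleton_subset_iff.2 hts.1) (ih hts.2)
  have hC_eq : convexHull ℝ s = C (Module.finrank ℝ E) := by
    refine Set.Subset.antisymm ?_ (hC_sub _)
    rw [convexHull_eq_union]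
    refine Set.iUnion_subset fun t => Set.iUnion₂_subset fun hts hind => ?_
    refine (hC_finset t hts).trans (hC_mono ?_)
    have hcard := hind.card_le_finrank_succ
    rw [Fintype.card_coe] at hcard
    have := Submodule.finrank_le (vectorSpan ℝ (Set.range ((↑) : t → E)))
    omega
  rw [hC_eq]
  exact hC_compact _

/-- Over an extreme point `x` of a set, the convex hull of a set of points of the epigraph of `f`
contains no point lying strictly below `f x`. -/
theorem le_snd_of_mem_convexHull_of_mem_extremePoints {E : Type*} [AddCommGroup E] [Module ℝ E]
    {K : Set E} (hK : Convex ℝ K) {f : E → ℝ} {G : Set (E × ℝ)}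
    (hG : ∀ p ∈ G, p.1 ∈ K ∧ f p.1 ≤ p.2) {x : E} (hx : x ∈ Set.extremePoints ℝ K) {t : ℝ}
    (ht : (x, t) ∈ convexHull ℝ G) : f x ≤ t := by
  have hconv : Convex ℝ {p : E × ℝ | p.1 ∈ K ∧ (p.1 = x → f x ≤ p.2)} := by
    rw [convex_iff_forall_pos]
    rintro ⟨p, r⟩ ⟨hp, hpr⟩ ⟨q, u⟩ ⟨hq, hqu⟩ a b ha hb hab
    refine ⟨hK hp hq ha.le hb.le hab, fun h => ?_⟩
    obtain ⟨h₁, h₂⟩ := (mem_extremePoints.1 hx).2 p hp q hq ⟨a, b, ha, hb, hab, h⟩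
    have hr := mul_le_mul_of_nonneg_left (hpr h₁) ha.le
    have hu := mul_le_mul_of_nonneg_left (hqu h₂) hb.le
    calc f x = a * f x + b * f x := by rw [← add_mul, hab, one_mul]
      _ ≤ a * r + b * u := add_le_add hr hu
  refine (convexHull_min (fun p hp => ?_) hconv ht).2 rfl
  exact ⟨(hG p hp).1, fun h => h ▸ (hG p hp).2⟩

/-- At an extreme point of the convex hull of its compact domain, a bounded lower semicontinuous
function admits approximate subgradients. -/
theorem exists_approx_subgradient_of_mem_extremePoints {E : Type*} [NormedAddCommGroup E]
    [InnerProductSpace ℝ E] [FiniteDimensional ℝ E] {D : Set E} (hD : IsCompact D) {f : E → ℝ}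
    (hf : LowerSemicontinuousOn f D) {c : ℝ} (hc : ∀ x ∈ D, |f x| ≤ c) {x₀ : E} (hx₀ : x₀ ∈ D)
    (hext : x₀ ∈ Set.extremePoints ℝ (convexHull ℝ D)) {ε : ℝ} (hε : 0 < ε) :
    ∃ y : E, ∀ x ∈ D, ⟪y, x⟫ - f x ≤ ⟪y, x₀⟫ - f x₀ + ε := by
  let G : Set (E × ℝ) := (D ×ˢ Set.Icc (-c) c) ∩ {p | p.1 ∈ D ∧ f p.1 ≤ p.2}
  have hG : IsCompact G := (hD.prod isCompact_Icc).inter_right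
    ((lowerSemicontinuousOn_iff_isClosed_epigraph hD.isClosed).1 hf)
  have hmem : ∀ x ∈ D, (x, f x) ∈ G := fun x hx => ⟨⟨hx, abs_le.1 (hc x hx)⟩, hx, le_rfl⟩
  have hnot : (x₀, f x₀ - ε) ∉ convexHull ℝ G := fun h => by
    have := le_snd_of_mem_convexHull_of_mem_extremePoints (convex_convexHull ℝ D)
      (fun p hp => ⟨subset_convexHull ℝ D hp.2.1, hp.2.2⟩) hext h
    linarith
  obtain ⟨g, u, hu, hgu⟩ := geometric_hahn_banach_point_closed (convex_convexHull ℝ G)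
    (isCompact_convexHull_of_finiteDimensional hG).isClosed hnot
  have hsplit (x : E) (t : ℝ) : g (x, t) = g (x, 0) + t * g (0, 1) := by
    rw [← smul_eq_mul, ← map_smul, ← map_add]
    simp
  have hlt : ∀ x ∈ D, g (x₀, 0) + (f x₀ - ε) * g (0, 1) < g (x, 0) + f x * g (0, 1) := by
    intro x hx
    rw [← hsplit, ← hsplit]
    exact hu.trans (hgu _ (subset_convexHull ℝ G (hmem x hx)))
  have hpos : 0 < g (0, 1) := by
    have := hlt x₀ hx₀
    exact pos_of_mul_pos_right (by linarith : 0 < ε * g (0, 1)) hε.le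
  let v : E := (InnerProductSpace.toDual ℝ E).symm (g.comp (ContinuousLinearMap.inl ℝ E ℝ))
  have hv (x : E) : ⟪v, x⟫ = g (x, 0) := by
    simp [v, InnerProductSpace.toDual_symm_apply]
  refine ⟨-((g (0, 1))⁻¹ • v), fun x hx => ?_⟩
  have h := mul_lt_mul_of_pos_left (hlt x hx) (inv_pos.2 hpos)
  have h_cancel (r : ℝ) : (g (0, 1))⁻¹ * (r * g (0, 1)) = r := by
    field_simp
  rw [mul_add, mul_add, h_cancel, h_cancel] at h
  simp only [inner_neg_left, real_inner_smul_left, hv]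
  linarith

theorem bddAbove_image_inner_sub_s19 {E : Type*} [NormedAddCommGroup E] [InnerProductSpace ℝ E]
    {D : Set E} (hD : IsCompact D) {f : E → ℝ} {c : ℝ} (hc : ∀ x ∈ D, |f x| ≤ c) (y : E) :
    BddAbove ((fun x => ⟪y, x⟫ - f x) '' D) := by
  obtain ⟨b, hb⟩ := hD.bddAbove_image (f := fun x => ⟪y, x⟫) (by fun_prop)
  refine ⟨b + c, ?_⟩
  rintro _ ⟨x, hx, rfl⟩
  have h₁ : ⟪y, x⟫ ≤ b := hb ⟨x, hx, rfl⟩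
  have h₂ := (abs_le.1 (hc x hx)).1
  dsimp only
  linarith

/-- at an extreme point of the convex hull of `D` the biconjugate matches `f`;
moreover a minimizer of a linear function over `D` which is an extreme point also minimizes
it over the convex hull of `D`. -/
theorem extreme_point_biconjugate
    (n m : ℕ) (Dset : Set (EuclideanSpace ℝ (Fin n)))
    (hDne : Dset.Nonempty) (hDcpt : IsCompact Dset)
    (f : EuclideanSpace ℝ (Fin n) → ℝ)
    (hflsc : LowerSemicontinuousOn f Dset)
    (hfbdd : ∃ c : ℝ, ∀ x ∈ Dset, |f x| ≤ c)
    (A : EuclideanSpace ℝ (Fin n) →ₗ[ℝ] EuclideanSpace ℝ (Fin m))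
    (lam : EuclideanSpace ℝ (Fin m))
    (xt : EuclideanSpace ℝ (Fin n)) (hxt : xt ∈ Dset)
    (hext : xt ∈ Set.extremePoints ℝ (convexHull ℝ Dset)) :
    fBiconj Dset f xt = f xt ∧
      ((∀ x ∈ Dset, ⟪lam, A xt⟫ ≤ ⟪lam, A x⟫) →
        ∀ x ∈ convexHull ℝ Dset, ⟪lam, A xt⟫ ≤ ⟪lam, A x⟫) := by
  obtain ⟨c, hc⟩ := hfbdd
  constructor
  · have hupper (y : EuclideanSpace ℝ (Fin n)) : ⟪y, xt⟫ - fConj Dset f y ≤ f xt := by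
      have : ⟪y, xt⟫ - f xt ≤ fConj Dset f y :=
        le_csSup (bddAbove_image_inner_sub_s19 hDcpt hc y) ⟨xt, hxt, rfl⟩
      linarith
    refine le_antisymm (csSup_le (Set.range_nonempty _) (Set.forall_mem_range.2 hupper)) ?_
    refine le_of_forall_pos_le_add fun ε hε => ?_
    obtain ⟨y, hy⟩ := exists_approx_subgradient_of_mem_extremePoints hDcpt hflsc hc hxt hext hε
    have hconj : fConj Dset f y ≤ ⟪y, xt⟫ - f xt + ε :=
      csSup_le (hDne.image _) (Set.forall_mem_image.2 hy)
    have hle : ⟪y, xt⟫ - fConj Dset f y ≤ fBiconj Dset f xt :=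
      le_csSup ⟨f xt, Set.forall_mem_range.2 hupper⟩ ⟨y, rfl⟩
    linarith
  · intro hmin
    exact convexHull_min hmin
      (convex_halfSpace_ge ((innerₛₗ ℝ lam).comp A).isLinear ⟪lam, A xt⟫)
end
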